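/- arXiv:2501.10005 — 10 statements merged into one kernel-verified Lean document; each statement's English description precedes it below -/
import Mathlib

section
/- Let R be a commutative ring with identity and M an R-module. Then M is a comorphic R-module if and only if for every submodule N of M such that M/N is a finitely cogenerated R-module, there exists a ∈ R such that N = aM and (N :_R M) = Ra + Ann_R(M). -/
open Pointwise

/-- A proper submodule `L` of a module is completely irreducible if whenever `L` is the
intersection of a family of submodules, it equals one of them. -/
def CompletelyIrreducible {R M : Type*} [CommRing R] [AddCommGroup M] [Module R M]
    (L : Submodule R M) : Prop :=
  L ≠ ⊤ ∧ ∀ S : Set (Submodule R M), L = sInf S → L ∈ S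

/-- `M` is a comorphic `R`-module if every completely irreducible submodule `L`
satisfies `L = aM` and `(L :_R M) = Ra + Ann_R(M)` for some `a ∈ R`. -/
def Comorphic (R M : Type*) [CommRing R] [AddCommGroup M] [Module R M] : Prop :=
  ∀ L : Submodule R M, CompletelyIrreducible L →
    ∃ a : R, L = a • (⊤ : Submodule R M) ∧
      L.colon ⊤ = Ideal.span {a} + (⊤ : Submodule R M).annihilator

/-- An `R`-module `X` is finitely cogenerated if every family of submodules with zero
intersection admits a finite subfamily with zero intersection. -/
def FinitelyCogenerated (R X : Type*) [CommRing R] [AddCommGroup X] [Module R X] : Prop :=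
  ∀ S : Set (Submodule R X), sInf S = ⊥ →
    ∃ T : Finset (Submodule R X), ↑T ⊆ S ∧ T.inf id = ⊥

section

variable {R M : Type*} [CommRing R] [AddCommGroup M] [Module R M]

/-- `N = aM` and `(N :_R M) = Ra + Ann_R(M)` for some `a ∈ R`. -/
def IsPrincipalMultiple (N : Submodule R M) : Prop :=
  ∃ a : R, N = a • (⊤ : Submodule R M) ∧
    N.colon ⊤ = Ideal.span {a} + (⊤ : Submodule R M).annihilator

theorem mem_span_singleton_add_annihilator_top {a r : R} :
    r ∈ Ideal.span {a} + (⊤ : Submodule R M).annihilator ↔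
      ∃ s : R, ∀ m : M, r • m = (s * a) • m := by
  rw [Submodule.add_eq_sup, Submodule.mem_sup]
  constructor
  · rintro ⟨y, hy, z, hz, rfl⟩
    obtain ⟨s, rfl⟩ := Ideal.mem_span_singleton'.1 hy
    refine ⟨s, fun m => ?_⟩
    rw [add_smul, Submodule.mem_annihilator.1 hz m trivial, add_zero]
  · rintro ⟨s, hs⟩
    refine ⟨s * a, Ideal.mem_span_singleton'.2 ⟨s, rfl⟩, r - s * a, ?_, by ring⟩
    exact Submodule.mem_annihilator.2 fun m _ => by rw [sub_smul, hs, sub_self]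

theorem isPrincipalMultiple_iff {N : Submodule R M} :
    IsPrincipalMultiple N ↔ ∃ a : R, (∀ x, x ∈ N ↔ ∃ m, a • m = x) ∧
      ∀ r : R, (∀ m : M, r • m ∈ N) → ∃ s : R, ∀ m : M, r • m = (s * a) • m := by
  refine exists_congr fun a => ?_
  constructor
  · rintro ⟨h₁, h₂⟩
    refine ⟨fun x => ?_, fun r hr => ?_⟩
    · rw [h₁, Submodule.mem_smul_pointwise_iff_exists]
      simp
    · rw [← mem_span_singleton_add_annihilator_top, ← h₂, Submodule.mem_colon]
      exact fun m _ => hr m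
  · rintro ⟨h₁, h₂⟩
    refine ⟨?_, ?_⟩
    · ext x
      rw [h₁, Submodule.mem_smul_pointwise_iff_exists]
      simp
    · ext r
      rw [mem_span_singleton_add_annihilator_top, Submodule.mem_colon]
      refine ⟨fun h => h₂ r fun m => h m trivial, ?_⟩
      rintro ⟨s, hs⟩ m -
      exact (h₁ _).2 ⟨s • m, by rw [hs, smul_smul, mul_comm]⟩

theorem isPrincipalMultiple_top : IsPrincipalMultiple (⊤ : Submodule R M) :=
  isPrincipalMultiple_iff.2 ⟨1, fun x => by simp, fun r _ => ⟨r, fun m => by simp⟩⟩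

theorem CompletelyIrreducible.comap {L : Submodule R M} (hL : CompletelyIrreducible L)
    (f : M →ₗ[R] M) (hf : L.comap f ≠ ⊤) : CompletelyIrreducible (L.comap f) := by
  refine ⟨hf, fun S hS => ?_⟩
  have hle : ∀ K ∈ S, L.comap f ≤ K := fun K hK => hS ▸ sInf_le hK
  have hne : S.Nonempty := by
    by_contra h
    rw [Set.not_nonempty_iff_eq_empty.1 h, sInf_empty] at hS
    exact hf hS
  obtain ⟨K, hK, hKL⟩ := hL.2 ((fun K => L ⊔ K.map f) '' S) <| by
    refine le_antisymm (le_sInf ?_) fun x hx => ?_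
    · rintro _ ⟨K, -, rfl⟩
      exact le_sup_left
    · have hx' : ∀ K ∈ S, ∃ l ∈ L, ∃ k ∈ K, l + f k = x := fun K hK => by
        obtain ⟨l, hl, _, ⟨k, hk, rfl⟩, h⟩ :=
          Submodule.mem_sup.1 (Submodule.mem_sInf.1 hx _ ⟨K, hK, rfl⟩)
        exact ⟨l, hl, k, hk, h⟩
      obtain ⟨K₀, hK₀⟩ := hne
      obtain ⟨l, hl, k, -, rfl⟩ := hx' K₀ hK₀
      suffices hk : k ∈ L.comap f from L.add_mem hl hk
      rw [hS, Submodule.mem_sInf]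
      intro K hK
      obtain ⟨l', hl', k', hk', h⟩ := hx' K hK
      have hsub : k - k' ∈ L.comap f := by
        rw [Submodule.mem_comap, map_sub,
          show f k - f k' = l' - l by rw [sub_eq_sub_iff_add_eq_add, h, add_comm]]
        exact L.sub_mem hl' hl
      simpa using K.add_mem (hle K hK hsub) hk'
  have hKle : K ≤ L.comap f := Submodule.map_le_iff_le_comap.1 (sup_eq_left.1 hKL)
  exact le_antisymm hKle (hle K hK) ▸ hK

theorem Comorphic.isPrincipalMultiple_inf (h : Comorphic R M) {N L : Submodule R M}
    (hN : IsPrincipalMultiple N) (hL : CompletelyIrreducible L) :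
    IsPrincipalMultiple (N ⊓ L) := by
  obtain ⟨a, ha, ha'⟩ := isPrincipalMultiple_iff.1 hN
  have hLa : IsPrincipalMultiple (L.comap (LinearMap.lsmul R M a)) := by
    by_cases htop : L.comap (LinearMap.lsmul R M a) = ⊤
    · exact htop ▸ isPrincipalMultiple_top
    · exact h _ (hL.comap _ htop)
  obtain ⟨c, hc, hc'⟩ := isPrincipalMultiple_iff.1 hLa
  simp only [Submodule.mem_comap, LinearMap.lsmul_apply] at hc hc'
  refine isPrincipalMultiple_iff.2 ⟨a * c, fun x => ⟨?_, ?_⟩, fun r hr => ?_⟩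
  · rintro ⟨hxN, hxL⟩
    obtain ⟨m, rfl⟩ := (ha x).1 hxN
    obtain ⟨n, rfl⟩ := (hc m).1 hxL
    exact ⟨n, mul_smul a c n⟩
  · rintro ⟨m, rfl⟩
    rw [mul_smul]
    exact ⟨(ha _).2 ⟨_, rfl⟩, (hc _).2 ⟨m, rfl⟩⟩
  · obtain ⟨s, hs⟩ := ha' r fun m => (hr m).1
    obtain ⟨u, hu⟩ := hc' s fun m => by
      rw [smul_smul, mul_comm, ← hs]
      exact (hr m).2
    refine ⟨u, fun m => ?_⟩
    rw [hs, mul_smul, hu, smul_smul, mul_assoc, mul_comm c a]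

theorem exists_completelyIrreducible_of_notMem {N : Submodule R M} {m : M} (hm : m ∉ N) :
    ∃ L, CompletelyIrreducible L ∧ N ≤ L ∧ m ∉ L := by
  obtain ⟨L, hNL, hL⟩ := zorn_le_nonempty₀ {L : Submodule R M | m ∉ L}
    (fun C hC hchain K hK => ⟨sSup C, fun hmem => by
      obtain ⟨P, hP, hmP⟩ := (Submodule.mem_sSup_of_directed ⟨K, hK⟩ hchain.directedOn).1 hmem
      exact hC hP hmP, fun _ => le_sSup⟩) N hm
  have hmL : m ∉ L := hL.prop
  refine ⟨L, ⟨fun htop => hmL (htop ▸ Submodule.mem_top), fun S hS => ?_⟩, hNL, hmL⟩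
  have hmS : ¬ ∀ K ∈ S, m ∈ K := by rwa [← Submodule.mem_sInf, ← hS]
  push Not at hmS
  obtain ⟨K, hK, hmK⟩ := hmS
  exact hL.eq_of_le hmK (hS ▸ sInf_le hK) ▸ hK

theorem sInf_completelyIrreducible_comap_mkQ (N : Submodule R M) :
    sInf {K : Submodule R (M ⧸ N) | CompletelyIrreducible (K.comap N.mkQ)} = ⊥ := by
  refine eq_bot_iff.2 fun x hx => ?_
  obtain ⟨m, rfl⟩ := N.mkQ_surjective x
  rw [Submodule.mem_bot, Submodule.mkQ_apply, Submodule.Quotient.mk_eq_zero]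
  by_contra hm
  obtain ⟨L, hL, hNL, hmL⟩ := exists_completelyIrreducible_of_notMem hm
  have hcomap : (L.map N.mkQ).comap N.mkQ = L := by
    rw [Submodule.comap_map_mkQ, sup_eq_right.2 hNL]
  refine hmL (hcomap ▸ Submodule.mem_sInf.1 hx (L.map N.mkQ) ?_)
  rwa [Set.mem_ofPred_eq, hcomap]

theorem CompletelyIrreducible.finitelyCogenerated_quotient {L : Submodule R M}
    (hL : CompletelyIrreducible L) : FinitelyCogenerated R (M ⧸ L) := by
  intro S hS
  obtain ⟨K, hK, hKL⟩ := hL.2 (Submodule.comap L.mkQ '' S) <| by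
    ext x
    rw [← (Submodule.Quotient.mk_eq_zero L), ← Submodule.mem_bot R, ← hS]
    simp [Submodule.mem_sInf]
  refine ⟨{K}, by simpa using hK, ?_⟩
  rw [Finset.inf_singleton, id_eq, ← Submodule.map_comap_eq_of_surjective L.mkQ_surjective K, hKL,
    Submodule.mkQ_map_self]

end

theorem comorphic_iff_finitelyCogenerated_quotients {R M : Type*} [CommRing R] [AddCommGroup M] [Module R M] :
    Comorphic R M ↔
      ∀ N : Submodule R M, FinitelyCogenerated R (M ⧸ N) →
        ∃ a : R, N = a • (⊤ : Submodule R M) ∧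
          N.colon ⊤ = Ideal.span {a} + (⊤ : Submodule R M).annihilator := by
  refine ⟨fun h N hN => ?_, fun h L hL => h L hL.finitelyCogenerated_quotient⟩
  obtain ⟨T, hTS, hT⟩ := hN _ (sInf_completelyIrreducible_comap_mkQ N)
  suffices hinf : IsPrincipalMultiple ((T.inf id).comap N.mkQ) by
    rwa [hT, Submodule.comap_bot, Submodule.ker_mkQ] at hinf
  clear hT
  induction T using Finset.cons_induction with
  | empty => exact isPrincipalMultiple_top
  | cons K T hK ih =>
    rw [Finset.coe_cons, Set.insert_subset_iff] at hTS
    rw [Finset.inf_cons, inf_comm, id_eq, Submodule.comap_inf]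
    exact h.isPrincipalMultiple_inf (ih hTS.2) hTS.1
end

section
/- Let R be a commutative ring with identity, let f : M → M' be a surjective R-linear map of R-modules, and let L' be a completely irreducible submodule of M'. Then the preimage f⁻¹(L') is a completely irreducible submodule of M. -/
open Pointwise

theorem completelyIrreducible_comap_of_surjective
    {R M M' : Type*} [CommRing R] [AddCommGroup M] [Module R M]
    [AddCommGroup M'] [Module R M'] (f : M →ₗ[R] M') (hf : Function.Surjective f)
    (L' : Submodule R M') (hL' : CompletelyIrreducible L') :
    CompletelyIrreducible (L'.comap f) := by
  have hker : LinearMap.ker f ≤ L'.comap f := Submodule.comap_mono bot_le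
  refine ⟨fun h => hL'.1 ?_, fun S hS => ?_⟩
  · rw [← Submodule.map_comap_eq_of_surjective hf L', h, Submodule.map_top,
      LinearMap.range_eq_top.2 hf]
  · have hcomap : ∀ N ∈ S, (N.map f).comap f = N := fun N hN =>
      Submodule.comap_map_eq_self (hker.trans (hS.le.trans (sInf_le hN)))
    have hinf : L' = sInf (Submodule.map f '' S) := by
      refine le_antisymm (le_sInf ?_) fun y hy => ?_
      · rintro _ ⟨N, hN, rfl⟩
        rw [← Submodule.map_comap_eq_of_surjective hf L']
        exact Submodule.map_mono (hS.le.trans (sInf_le hN))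
      · obtain ⟨x, rfl⟩ := hf y
        change x ∈ L'.comap f
        rw [hS, Submodule.mem_sInf]
        intro N hN
        rw [← hcomap N hN]
        exact Submodule.mem_sInf.1 hy _ ⟨N, hN, rfl⟩
    obtain ⟨N, hN, hNL⟩ := hL'.2 _ hinf
    rwa [← hNL, hcomap N hN]
end

section
/- Let R be a commutative ring with identity and let f : M → M' be a surjective R-linear map of R-modules. If M is a comorphic R-module, then M' is a comorphic R-module. -/
open Pointwise

theorem CompletelyIrreducible.comap_of_surjective
    {R M M' : Type*} [CommRing R] [AddCommGroup M] [Module R M]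
    [AddCommGroup M'] [Module R M'] {f : M →ₗ[R] M'} (hf : Function.Surjective f)
    {L : Submodule R M'} (hL : CompletelyIrreducible L) :
    CompletelyIrreducible (L.comap f) := by
  refine ⟨fun h => hL.1 ?_, fun S hS => ?_⟩
  · rw [← Submodule.map_comap_eq_of_surjective hf L, h, Submodule.map_top,
      LinearMap.range_eq_top.2 hf]
  · have comap_map : ∀ N ∈ S, (N.map f).comap f = N := fun N hN =>
      Submodule.comap_map_eq_self
        ((Submodule.comap_mono bot_le).trans (hS.trans_le (sInf_le hN)))
    have hmap : L = sInf (Submodule.map f '' S) := by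
      apply Submodule.comap_injective_of_surjective hf
      rw [hS, sInf_image]
      simp only [Submodule.comap_iInf]
      rw [sInf_eq_iInf]
      exact iInf_congr fun N => iInf_congr fun hN => (comap_map N hN).symm
    obtain ⟨N, hN, rfl⟩ := hL.2 _ hmap
    rwa [comap_map N hN]

theorem comorphic_of_surjective
    {R M M' : Type*} [CommRing R] [AddCommGroup M] [Module R M]
    [AddCommGroup M'] [Module R M'] (f : M →ₗ[R] M') (hf : Function.Surjective f)
    (hM : Comorphic R M) : Comorphic R M' := by
  intro L hL
  obtain ⟨a, ha, hcolon⟩ := hM _ (hL.comap_of_surjective hf)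
  have hLa : L = a • (⊤ : Submodule R M') := by
    rw [← Submodule.map_comap_eq_of_surjective hf L, ha, Submodule.map_pointwise_smul,
      Submodule.map_top, LinearMap.range_eq_top.2 hf]
  refine ⟨a, hLa, le_antisymm (fun r hr => ?_) (sup_le ?_ fun r hr => ?_)⟩
  · have hr' : r ∈ (L.comap f).colon ⊤ := Submodule.mem_colon.2 fun x _ => by
      simpa using Submodule.mem_colon.1 hr (f x) trivial
    rw [hcolon] at hr'
    refine sup_le_sup_left (fun s hs => ?_) (Ideal.span {a}) hr'
    refine Submodule.mem_annihilator.2 fun y _ => ?_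
    obtain ⟨x, rfl⟩ := hf y
    rw [← map_smul, Submodule.mem_annihilator.1 hs x trivial, map_zero]
  · rw [Ideal.span_singleton_le_iff_mem, Submodule.mem_colon]
    intro y _
    rw [hLa]
    exact Submodule.smul_mem_pointwise_smul y a ⊤ trivial
  · refine Submodule.mem_colon.2 fun y _ => ?_
    rw [Submodule.mem_annihilator.1 hr y trivial]
    exact L.zero_mem
end

section
/- Let R be a commutative ring with identity and M an R-module. Then M is both a second module and a comorphic R-module if and only if M is a simple R-module. -/
open Pointwise

theorem Submodule.exists_le_maximal_notMem {R M : Type*} [Semiring R] [AddCommMonoid M]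
    [Module R M] {N : Submodule R M} {x : M} (hx : x ∉ N) :
    ∃ L, N ≤ L ∧ Maximal (fun L : Submodule R M ↦ x ∉ L) L := by
  refine zorn_le_nonempty₀ {L : Submodule R M | x ∉ L} (fun c hc hchain y hy ↦ ?_) N hx
  refine ⟨sSup c, fun hmem ↦ ?_, fun _ ↦ le_sSup⟩
  obtain ⟨L, hL, hxL⟩ := (Submodule.mem_sSup_of_directed ⟨y, hy⟩ hchain.directedOn).1 hmem
  exact hc hL hxL

theorem CompletelyIrreducible.of_maximal_notMem {R M : Type*} [CommRing R] [AddCommGroup M]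
    [Module R M] {L : Submodule R M} {x : M}
    (h : Maximal (fun L : Submodule R M ↦ x ∉ L) L) : CompletelyIrreducible L := by
  refine ⟨fun hL ↦ h.prop (hL ▸ Submodule.mem_top), fun S hS ↦ ?_⟩
  by_contra hLS
  refine h.prop (hS ▸ Submodule.mem_sInf.2 fun N hN ↦ ?_)
  by_contra hxN
  have hle : L ≤ N := hS.trans_le (sInf_le hN)
  exact hLS (h.eq_of_le hxN hle ▸ hN)

theorem second_comorphic_iff_simple {R M : Type*} [CommRing R] [AddCommGroup M] [Module R M] :
    (((⊤ : Submodule R M) ≠ ⊥ ∧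
        ∀ a : R, a • (⊤ : Submodule R M) = ⊤ ∨ a • (⊤ : Submodule R M) = ⊥) ∧
      Comorphic R M) ↔ IsSimpleModule R M := by
  constructor
  · rintro ⟨⟨hne, hsecond⟩, hco⟩
    have : Nontrivial (Submodule R M) := ⟨⟨⊤, ⊥, hne⟩⟩
    refine (isSimpleModule_iff R M).2 ⟨fun N ↦ or_iff_not_imp_right.2 fun hN ↦ ?_⟩
    obtain ⟨x, -, hx⟩ := SetLike.exists_of_lt (lt_top_iff_ne_top.2 hN)
    obtain ⟨L, hNL, hL⟩ := Submodule.exists_le_maximal_notMem hx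
    have hirr := CompletelyIrreducible.of_maximal_notMem hL
    obtain ⟨a, ha, -⟩ := hco L hirr
    have hbot : L = ⊥ := ha.trans ((hsecond a).resolve_left fun h ↦ hirr.1 (ha.trans h))
    exact le_bot_iff.1 (hbot ▸ hNL)
  · intro h
    refine ⟨⟨top_ne_bot, fun a ↦ (eq_bot_or_eq_top _).symm⟩, fun L hL ↦ ⟨0, ?_, ?_⟩⟩
    · simpa using (eq_bot_or_eq_top L).resolve_right hL.1
    · rw [(eq_bot_or_eq_top L).resolve_right hL.1]
      ext r
      simp [Submodule.mem_colon, Submodule.mem_annihilator]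
end

section
/- Let R be a commutative ring with identity and M a comorphic R-module. Then for every submodule N of M such that M/N is a finitely cogenerated R-module, there exists a ∈ R with N = (N :_R M)M = aM. -/
open Pointwise

section

variable {R M : Type*} [CommRing R] [AddCommGroup M] [Module R M]

/-- A submodule `L` is completely irreducible iff some element outside `L` lies in every strictly
larger submodule. -/
theorem completelyIrreducible_iff_exists {L : Submodule R M} :
    CompletelyIrreducible L ↔ ∃ x ∉ L, ∀ K, L < K → x ∈ K := by
  constructor
  · rintro ⟨-, h⟩
    by_contra! hx
    refine lt_irrefl L (h {K | L < K}
      (le_antisymm (le_sInf fun K hK => le_of_lt hK) fun x hxS => ?_))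
    by_contra hxL
    obtain ⟨K, hK, hxK⟩ := hx x hxL
    exact hxK ((Submodule.mem_sInf.1 hxS) K hK)
  · rintro ⟨x, hxL, hx⟩
    refine ⟨fun h => hxL (h ▸ Submodule.mem_top), fun S hS => ?_⟩
    by_contra hLS
    have hmem : x ∈ sInf S := Submodule.mem_sInf.2 fun K hK =>
      hx K (lt_of_le_of_ne (hS ▸ sInf_le hK) fun h => hLS (h ▸ hK))
    exact hxL (hS ▸ hmem)

/-- The preimage of a completely irreducible submodule is completely irreducible or everything. -/
theorem CompletelyIrreducible.comap_or_eq_top {M' : Type*} [AddCommGroup M'] [Module R M']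
    {L : Submodule R M} (hL : CompletelyIrreducible L) (f : M' →ₗ[R] M) :
    CompletelyIrreducible (L.comap f) ∨ L.comap f = ⊤ := by
  obtain ⟨x, hxL, hx⟩ := completelyIrreducible_iff_exists.1 hL
  have key : ∀ K, L.comap f < K → ∃ k ∈ K, x - f k ∈ L := by
    intro K hK
    obtain ⟨k, hkK, hk⟩ := SetLike.exists_of_lt hK
    have hlt : L < L ⊔ K.map f := left_lt_sup.2 fun h =>
      hk (h (Submodule.mem_map_of_mem hkK))
    obtain ⟨l, hl, _, ⟨k', hk', rfl⟩, rfl⟩ := Submodule.mem_sup.1 (hx _ hlt)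
    exact ⟨k', hk', by simpa using hl⟩
  refine or_iff_not_imp_right.2 fun htop => ?_
  obtain ⟨m, -, hm⟩ := key ⊤ (lt_top_iff_ne_top.2 htop)
  refine completelyIrreducible_iff_exists.2 ⟨m, fun h => hxL ?_, fun K hK => ?_⟩
  · simpa using L.add_mem hm h
  · obtain ⟨k, hkK, hk⟩ := key K hK
    have hmk : m - k ∈ L.comap f := by
      simpa using L.sub_mem hk hm
    simpa using K.add_mem (hK.le hmk) hkK

/-- Any element outside `N` is separated from `N` by a completely irreducible submodule. -/
theorem exists_completelyIrreducible_notMem {N : Submodule R M} {x : M} (hx : x ∉ N) :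
    ∃ L, N ≤ L ∧ CompletelyIrreducible L ∧ x ∉ L := by
  obtain ⟨L, hNL, hL⟩ := zorn_le_nonempty₀ {K : Submodule R M | x ∉ K} (fun c hc hchain y hy =>
    ⟨sSup c, fun h => by
      obtain ⟨K, hK, hxK⟩ :=
        (Submodule.mem_sSup_of_directed ⟨y, hy⟩ hchain.directedOn).1 h
      exact hc hK hxK, fun z hz => le_sSup hz⟩) N hx
  refine ⟨L, hNL, completelyIrreducible_iff_exists.2 ⟨x, hL.prop, fun K hK => ?_⟩, hL.prop⟩
  by_contra hxK
  exact hL.not_prop_of_gt hK hxK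

/-- In a comorphic module, the intersection of a completely irreducible submodule with a submodule
of the form `aM` has the same form. -/
theorem Comorphic.exists_smul_top_inf_eq (hM : Comorphic R M) {L : Submodule R M}
    (hL : CompletelyIrreducible L) (a : R) :
    ∃ b : R, L ⊓ a • (⊤ : Submodule R M) = b • (⊤ : Submodule R M) := by
  obtain ⟨c, hc⟩ : ∃ c : R, L.comap (LinearMap.lsmul R M a) = c • (⊤ : Submodule R M) := by
    obtain h | h := hL.comap_or_eq_top (LinearMap.lsmul R M a)
    · obtain ⟨c, hc, -⟩ := hM _ h
      exact ⟨c, hc⟩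
    · exact ⟨1, by rw [h, one_smul]⟩
  refine ⟨a * c, ?_⟩
  rw [mul_smul, ← hc]
  ext y
  simp only [Submodule.mem_inf, Submodule.mem_smul_pointwise_iff_exists, Submodule.mem_comap,
    LinearMap.lsmul_apply, Submodule.mem_top, true_and]
  constructor
  · rintro ⟨hy, m, rfl⟩
    exact ⟨m, hy, rfl⟩
  · rintro ⟨m, hm, rfl⟩
    exact ⟨hm, m, rfl⟩

/-- In a comorphic module, a finite intersection of completely irreducible submodules has the
form `aM`. -/
theorem Comorphic.exists_finset_inf_eq_smul_top (hM : Comorphic R M) {ι : Type*} (T : Finset ι)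
    (L : ι → Submodule R M) (hL : ∀ i ∈ T, CompletelyIrreducible (L i)) :
    ∃ a : R, T.inf L = a • (⊤ : Submodule R M) := by
  classical
  induction T using Finset.induction_on with
  | empty => exact ⟨1, by simp⟩
  | insert i T _ ih =>
    obtain ⟨a, ha⟩ := ih fun j hj => hL j (Finset.mem_insert_of_mem hj)
    rw [Finset.inf_insert, ha]
    exact hM.exists_smul_top_inf_eq (hL i (Finset.mem_insert_self i T)) a

/-- If `M ⧸ N` is finitely cogenerated, then `N` is a finite intersection of completely
irreducible submodules. -/
theorem FinitelyCogenerated.exists_finset_inf_eq {N : Submodule R M}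
    (hN : FinitelyCogenerated R (M ⧸ N)) :
    ∃ T : Finset (Submodule R (M ⧸ N)),
      (∀ K ∈ T, CompletelyIrreducible (K.comap N.mkQ)) ∧
        T.inf (Submodule.comap N.mkQ) = N := by
  obtain ⟨T, hTS, hT⟩ := hN {K | CompletelyIrreducible (K.comap N.mkQ)} (by
    refine (Submodule.eq_bot_iff _).2 fun y hy => ?_
    obtain ⟨x, rfl⟩ := N.mkQ_surjective y
    by_contra hxN
    have hx : x ∉ N := fun h => hxN (by simpa using h)
    obtain ⟨L, hNL, hL, hxL⟩ := exists_completelyIrreducible_notMem hx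
    have hcomap : (L.map N.mkQ).comap N.mkQ = L := by
      rw [Submodule.comap_map_mkQ, sup_eq_right.2 hNL]
    have hmem := Submodule.mem_sInf.1 hy (L.map N.mkQ) (by simpa only [Set.mem_ofPred_eq, hcomap])
    exact hxL (hcomap ▸ hmem))
  refine ⟨T, fun K hK => hTS hK, ?_⟩
  have hcomp : (T.inf id).comap N.mkQ = T.inf (Submodule.comap N.mkQ) :=
    Finset.apply_inf_eq_inf_comp (Submodule.comap N.mkQ) (fun _ _ => rfl) rfl
  rw [← hcomp, hT, ← LinearMap.ker, Submodule.ker_mkQ]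

end

theorem comorphic_submodule_eq_colon_smul {R M : Type*} [CommRing R] [AddCommGroup M] [Module R M]
    (hM : Comorphic R M) :
    ∀ N : Submodule R M, FinitelyCogenerated R (M ⧸ N) →
      ∃ a : R, N = N.colon ⊤ • (⊤ : Submodule R M) ∧
        N = a • (⊤ : Submodule R M) := by
  intro N hN
  obtain ⟨T, hT, hTN⟩ := hN.exists_finset_inf_eq
  obtain ⟨a, ha⟩ := hM.exists_finset_inf_eq_smul_top T _ hT
  rw [hTN] at ha
  refine ⟨a, le_antisymm (fun x hx => ?_) ?_, ha⟩
  · obtain ⟨m, -, rfl⟩ := (Submodule.mem_smul_pointwise_iff_exists x a ⊤).1 (ha ▸ hx)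
    refine Submodule.smul_mem_smul (Submodule.mem_colon.2 fun p _ => ?_) Submodule.mem_top
    rw [ha]
    exact Submodule.smul_mem_pointwise_smul p a ⊤ Submodule.mem_top
  · exact Submodule.smul_le.2 fun r hr m _ => Submodule.mem_colon.1 hr m trivial
end

section
/- Let R be a commutative ring with identity and M a comorphic R-module which satisfies the double annihilator condition (DAC) and for which I^M_0(M) ≠ 0. Then the following are equivalent: (a) M satisfies the ascending chain condition on completely irreducible submodules; (b) R satisfies the ascending chain condition on the set of ideals {(L :_R M) : L a completely irreducible submodule of M}; (c) M satisfies the ascending chain condition on submodules N with M/N finitely cogenerated; (d) R satisfies the ascending chain condition on the set of ideals {(N :_R M) : N a submodule with M/N finitely cogenerated}. -/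
open Pointwise

/-- `M` satisfies the double annihilator condition: `I = Ann_R((0 :_M I))` for every ideal `I`. -/
def SatisfiesDAC (R M : Type*) [CommRing R] [AddCommGroup M] [Module R M] : Prop :=
  ∀ I : Ideal R, I = (Submodule.torsionBySet R M (I : Set R)).annihilator

/-- `I^M_0(M)`: the intersection of all completely irreducible submodules `L` of `M`
such that `rM ⊆ L` for some nonzero `r ∈ R`. -/
def I0 (R M : Type*) [CommRing R] [AddCommGroup M] [Module R M] : Submodule R M :=
  sInf {L : Submodule R M | CompletelyIrreducible L ∧
    ∃ r : R, r ≠ 0 ∧ r • (⊤ : Submodule R M) ≤ L}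

/-- A partially ordered type satisfies the ascending chain condition on elements
satisfying `P` if every ascending chain of such elements stabilizes. -/
def ACCOn {α : Type*} [Preorder α] (P : α → Prop) : Prop :=
  ∀ f : ℕ →o α, (∀ n, P (f n)) → ∃ n, ∀ m, n ≤ m → f m = f n

section

variable {R M : Type*} [CommRing R] [AddCommGroup M] [Module R M]

theorem exists_completelyIrreducible_not_mem (N : Submodule R M) {x : M} (hx : x ∉ N) :
    ∃ L : Submodule R M, CompletelyIrreducible L ∧ N ≤ L ∧ x ∉ L := by
  obtain ⟨L, hNL, hL⟩ := zorn_le_nonempty₀ {K : Submodule R M | x ∉ K} (by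
    intro c hc hchain y hy
    refine ⟨sSup c, ?_, fun z hz => le_sSup hz⟩
    intro hmem
    obtain ⟨K, hK, hxK⟩ := (Submodule.mem_sSup_of_directed ⟨y, hy⟩ hchain.directedOn).1 hmem
    exact hc hK hxK) N hx
  have hxL : x ∉ L := hL.prop
  refine ⟨L, ⟨fun h => hxL (h ▸ Submodule.mem_top), fun S hS => ?_⟩, hNL, hxL⟩
  by_contra hLS
  apply hxL
  rw [hS, Submodule.mem_sInf]
  intro K hK
  by_contra hxK
  have hLK : L ≤ K := hS.trans_le (sInf_le hK)
  exact hLS (hL.eq_of_le hxK hLK ▸ hK)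

theorem SatisfiesDAC.eq_zero_of_smul (hdac : SatisfiesDAC R M) {r : R}
    (hr : ∀ m : M, r • m = 0) : r = 0 := by
  have h := hdac ⊥
  rw [← Ideal.mem_bot, h, Submodule.mem_annihilator]
  exact fun m _ => hr m

theorem Comorphic.exists_eq_smul_top (hM : Comorphic R M) (hdac : SatisfiesDAC R M)
    {L : Submodule R M} (hL : CompletelyIrreducible L) :
    ∃ a : R, L = a • (⊤ : Submodule R M) ∧ ∀ r : R, (∀ m : M, r • m ∈ L) ↔ a ∣ r := by
  obtain ⟨a, rfl, ha⟩ := hM L hL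
  refine ⟨a, rfl, fun r => ?_⟩
  have hann : (⊤ : Submodule R M).annihilator = ⊥ := by
    refine eq_bot_iff.2 fun r hr => hdac.eq_zero_of_smul fun m => ?_
    exact Submodule.mem_annihilator.1 hr m Submodule.mem_top
  rw [hann, Submodule.add_eq_sup, sup_bot_eq] at ha
  rw [← Ideal.mem_span_singleton, ← ha, Submodule.mem_colon]
  simp

theorem completelyIrreducible_bot (hM : Comorphic R M) (hI0 : I0 R M ≠ ⊥) :
    CompletelyIrreducible (⊥ : Submodule R M) := by
  by_contra hbot
  refine hI0 (eq_bot_iff.2 fun x hx => ?_)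
  by_contra hx0
  obtain ⟨L, hL, -, hxL⟩ := exists_completelyIrreducible_not_mem ⊥ hx0
  obtain ⟨a, ha, -⟩ := hM L hL
  refine hxL (Submodule.mem_sInf.1 hx L ⟨hL, a, ?_, ha.ge⟩)
  rintro rfl
  rw [zero_smul] at ha
  rw [ha] at hL
  exact hbot hL

theorem CompletelyIrreducible.exists_mem_of_ne_bot
    (hbot : CompletelyIrreducible (⊥ : Submodule R M)) :
    ∃ s : M, s ≠ 0 ∧ ∀ N : Submodule R M, N ≠ ⊥ → s ∈ N := by
  have h : sInf {N : Submodule R M | N ≠ ⊥} ≠ ⊥ := fun h => hbot.2 _ h.symm rfl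
  obtain ⟨s, hs, hs0⟩ := Submodule.exists_mem_ne_zero_of_ne_bot h
  exact ⟨s, hs0, fun N hN => Submodule.mem_sInf.1 hs N hN⟩

theorem completelyIrreducible_torsionBy {s : M} (hs0 : s ≠ 0)
    (hs : ∀ N : Submodule R M, N ≠ ⊥ → s ∈ N) {a : R} (ha : ∃ m : M, a • m ≠ 0) :
    CompletelyIrreducible (Submodule.torsionBy R M a) := by
  have key : ∀ n : M, a • n ≠ 0 → ∃ r : R, a • r • n = s := by
    intro n hn
    obtain ⟨r, hr⟩ := Submodule.mem_span_singleton.1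
      (hs (Submodule.span R {a • n}) (by simpa using hn))
    exact ⟨r, by rw [smul_comm, hr]⟩
  obtain ⟨m, hm⟩ := ha
  refine ⟨fun h => hm ?_, fun S hS => ?_⟩
  · rw [← Submodule.mem_torsionBy_iff, h]
    exact Submodule.mem_top
  by_contra hmem
  obtain ⟨r, hr⟩ := key m hm
  refine hs0 (hr ▸ (Submodule.mem_torsionBy_iff a (r • m)).1 ?_)
  rw [hS, Submodule.mem_sInf]
  intro K hK
  have hle : Submodule.torsionBy R M a ≤ K := hS.trans_le (sInf_le hK)
  have hnle : ¬ K ≤ Submodule.torsionBy R M a := fun h => hmem (le_antisymm hle h ▸ hK)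
  obtain ⟨n, hnK, hn⟩ := SetLike.not_le_iff_exists.1 hnle
  obtain ⟨t, ht⟩ := key n hn
  have hsub : r • m - t • n ∈ K := hle (by
    rw [Submodule.mem_torsionBy_iff, smul_sub, hr, ht, sub_self])
  simpa using K.add_mem hsub (K.smul_mem t hnK)

/-- The ring of scalars is morphic: every `a` has a `b` with `Ann(a) = Rb` and `Ann(b) = Ra`. -/
theorem Comorphic.exists_annihilators (hM : Comorphic R M) (hdac : SatisfiesDAC R M)
    (hbot : CompletelyIrreducible (⊥ : Submodule R M)) (a : R) :
    ∃ b : R, (∀ r, r * a = 0 ↔ b ∣ r) ∧ ∀ r, r * b = 0 ↔ a ∣ r := by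
  by_cases ha : a = 0
  · exact ⟨1, by simp [ha], by simp [ha]⟩
  obtain ⟨s, hs0, hs⟩ := hbot.exists_mem_of_ne_bot
  have ha' : ∃ m : M, a • m ≠ 0 := by
    by_contra! h
    exact ha (hdac.eq_zero_of_smul h)
  obtain ⟨b, hb, hdvd⟩ :=
    hM.exists_eq_smul_top hdac (completelyIrreducible_torsionBy hs0 hs ha')
  refine ⟨b, fun r => ?_, fun r => ?_⟩
  · rw [← hdvd]
    refine ⟨fun h m => ?_, fun h => hdac.eq_zero_of_smul fun m => ?_⟩
    · rw [Submodule.mem_torsionBy_iff, smul_smul, mul_comm, h, zero_smul]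
    · rw [mul_comm, mul_smul]
      exact (Submodule.mem_torsionBy_iff a _).1 (h m)
  · rw [← Ideal.mem_span_singleton, hdac (Ideal.span {a}), Submodule.torsionBySet_span_singleton_eq,
      hb, Submodule.mem_annihilator]
    refine ⟨fun h n hn => ?_, fun h => hdac.eq_zero_of_smul fun m => ?_⟩
    · obtain ⟨m, -, rfl⟩ := (Submodule.mem_smul_pointwise_iff_exists n b ⊤).1 hn
      rw [smul_smul, h, zero_smul]
    · rw [mul_smul]
      exact h _ (Submodule.smul_mem_pointwise_smul m b ⊤ Submodule.mem_top)

theorem SatisfiesDAC.isLocalRing (hdac : SatisfiesDAC R M)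
    (hbot : CompletelyIrreducible (⊥ : Submodule R M)) : IsLocalRing R := by
  obtain ⟨s, hs0, hs⟩ := hbot.exists_mem_of_ne_bot
  have : Nontrivial R := by
    by_contra h
    rw [not_nontrivial_iff_subsingleton] at h
    exact hs0 (by rw [← one_smul R s, Subsingleton.elim (1 : R) 0, zero_smul])
  have key : ∀ x ∈ nonunits R, x • s = 0 := by
    intro x hx
    refine (Submodule.mem_torsionBy_iff x s).1 (hs _ fun h => hx ?_)
    have h1 := hdac (Ideal.span {x})
    rw [Submodule.torsionBySet_span_singleton_eq, h, Submodule.annihilator_bot] at h1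
    exact Ideal.span_singleton_eq_top.1 h1
  refine IsLocalRing.of_nonunits_add fun x y hx hy hxy => hs0 ?_
  rw [← hxy.smul_eq_zero, add_smul, key x hx, key y hy, add_zero]

/-- In a local morphic ring divisibility is total. -/
theorem dvd_total_of_exists_annihilators [IsLocalRing R]
    (h : ∀ a : R, ∃ b : R, (∀ r, r * a = 0 ↔ b ∣ r) ∧ ∀ r, r * b = 0 ↔ a ∣ r) (a b : R) :
    a ∣ b ∨ b ∣ a := by
  obtain ⟨c, -, hc⟩ := h b
  obtain ⟨d, -, hd⟩ := h (a * c)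
  obtain ⟨e, he, -⟩ := h (c * d)
  have ha : e ∣ a := (he a).1 (by
    rw [← mul_assoc]
    exact (hd _).2 dvd_rfl)
  have hb : e ∣ b := (he b).1 (by rw [← mul_assoc, (hc b).2 dvd_rfl, zero_mul])
  have hecd : e * c * d = 0 := by rw [mul_assoc]; exact (he e).2 dvd_rfl
  obtain ⟨p, hp⟩ := (hd _).1 hecd
  obtain ⟨q, hq⟩ := (hc (e - a * p)).1 (by linear_combination hp)
  obtain ⟨u, rfl⟩ := ha
  obtain ⟨v, rfl⟩ := hb
  by_cases hu : IsUnit u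
  · exact .inl (mul_dvd_mul_left e hu.dvd)
  by_cases hv : IsUnit v
  · exact .inr (mul_dvd_mul_left e hv.dvd)
  have hw : IsUnit (1 - (u * p + v * q)) := by
    refine (IsLocalRing.isUnit_or_isUnit_one_sub_self (u * p + v * q)).resolve_left ?_
    exact IsLocalRing.nonunits_add (fun h => hu (isUnit_of_mul_isUnit_left h))
      (fun h => hv (isUnit_of_mul_isUnit_left h))
  have he0 : e = 0 := hw.mul_left_eq_zero.1 (by linear_combination hq)
  simp [he0]

theorem CompletelyIrreducible.le_total (hM : Comorphic R M) (hdac : SatisfiesDAC R M)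
    (hI0 : I0 R M ≠ ⊥) {L L' : Submodule R M} (hL : CompletelyIrreducible L)
    (hL' : CompletelyIrreducible L') : L ≤ L' ∨ L' ≤ L := by
  have hbot := completelyIrreducible_bot hM hI0
  have := hdac.isLocalRing hbot
  have key : ∀ {a b : R}, a ∣ b → b • (⊤ : Submodule R M) ≤ a • ⊤ := by
    rintro a _ ⟨c, rfl⟩
    rw [mul_smul]
    exact smul_mono_right a le_top
  obtain ⟨a, rfl, -⟩ := hM L hL
  obtain ⟨b, rfl, -⟩ := hM L' hL'
  exact (dvd_total_of_exists_annihilators (hM.exists_annihilators hdac hbot) a b).symm.imp key key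

theorem CompletelyIrreducible.finitelyCogenerated {N : Submodule R M}
    (hN : CompletelyIrreducible N) : FinitelyCogenerated R (M ⧸ N) := by
  intro S hS
  obtain ⟨K, hK, hKN⟩ := hN.2 (Submodule.comap N.mkQ '' S) (by
    rw [sInf_image]
    simp_rw [← Submodule.comap_iInf]
    rw [← sInf_eq_iInf, hS, Submodule.comap_bot, Submodule.ker_mkQ])
  refine ⟨{K}, by simpa using hK, ?_⟩
  rw [Finset.inf_singleton, id, ← Submodule.map_comap_eq_of_surjective N.mkQ_surjective K, hKN,
    Submodule.mkQ_map_self]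

theorem finitelyCogenerated_quotient_iff
    (htotal : ∀ L L' : Submodule R M, CompletelyIrreducible L → CompletelyIrreducible L' →
      L ≤ L' ∨ L' ≤ L) (N : Submodule R M) :
    FinitelyCogenerated R (M ⧸ N) ↔ N = ⊤ ∨ CompletelyIrreducible N := by
  constructor
  · intro h
    obtain ⟨T, hTS, hT⟩ := h
      {K | ∃ L : Submodule R M, CompletelyIrreducible L ∧ N ≤ L ∧ K = L.map N.mkQ} (by
        refine eq_bot_iff.2 fun y hy => ?_
        obtain ⟨x, rfl⟩ := N.mkQ_surjective y
        by_contra hx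
        have hxN : x ∉ N := by simpa using hx
        obtain ⟨L, hL, hNL, hxL⟩ := exists_completelyIrreducible_not_mem N hxN
        have hmem := Submodule.mem_sInf.1 hy _ ⟨L, hL, hNL, rfl⟩
        rw [← Submodule.mem_comap, Submodule.comap_map_mkQ, sup_eq_right.2 hNL] at hmem
        exact hxL hmem)
    have hp : T.inf id = ⊤ ∨
        ∃ L : Submodule R M, CompletelyIrreducible L ∧ N ≤ L ∧ T.inf id = L.map N.mkQ := by
      refine Finset.inf_induction (p := fun K => K = ⊤ ∨
        ∃ L : Submodule R M, CompletelyIrreducible L ∧ N ≤ L ∧ K = L.map N.mkQ)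
        (.inl rfl) ?_ fun K hK => .inr (hTS hK)
      rintro K (rfl | ⟨L, hL, hNL, rfl⟩) K' (rfl | ⟨L', hL', hNL', rfl⟩)
      · exact .inl (top_inf_eq _)
      · exact .inr ⟨L', hL', hNL', top_inf_eq _⟩
      · exact .inr ⟨L, hL, hNL, inf_top_eq _⟩
      · rcases htotal L L' hL hL' with hle | hle
        · exact .inr ⟨L, hL, hNL, inf_eq_left.2 (Submodule.map_mono hle)⟩
        · exact .inr ⟨L', hL', hNL', inf_eq_right.2 (Submodule.map_mono hle)⟩
    rw [hT] at hp
    rcases hp with hp | ⟨L, hL, hNL, hp⟩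
    · left
      have := congrArg (Submodule.comap N.mkQ) hp
      simpa using this
    · right
      have := congrArg (Submodule.comap N.mkQ) hp
      rw [Submodule.comap_map_mkQ, sup_eq_right.2 hNL, Submodule.comap_bot,
        Submodule.ker_mkQ] at this
      exact this ▸ hL
  · rintro (rfl | hN)
    · exact fun S _ => ⟨∅, by simp, Subsingleton.elim _ _⟩
    · exact hN.finitelyCogenerated

end

theorem ACCOn.image_iff {α β : Type*} [PartialOrder α] [PartialOrder β] {P : α → Prop}
    {g : α → β} (hg : Monotone g) (hrefl : ∀ x y, P x → P y → g x ≤ g y → x ≤ y) :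
    ACCOn P ↔ ACCOn (fun b => ∃ x, P x ∧ b = g x) := by
  constructor
  · intro h f hf
    choose x hx hfx using hf
    obtain ⟨n, hn⟩ := h ⟨x, fun i j hij => hrefl _ _ (hx i) (hx j) (by
      rw [← hfx, ← hfx]; exact f.monotone hij)⟩ hx
    refine ⟨n, fun m hm => ?_⟩
    rw [hfx, hfx]
    exact congrArg g (hn m hm)
  · intro h f hf
    obtain ⟨n, hn⟩ := h ⟨fun i => g (f i), hg.comp f.monotone⟩ fun i => ⟨f i, hf i, rfl⟩
    exact ⟨n, fun m hm => le_antisymm (hrefl _ _ (hf m) (hf n) (hn m hm).le) (f.monotone hm)⟩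

theorem ACCOn.eq_top_or_iff {α : Type*} [PartialOrder α] [OrderTop α] {P : α → Prop} :
    ACCOn (fun x => x = ⊤ ∨ P x) ↔ ACCOn P := by
  refine ⟨fun h f hf => h f fun n => .inr (hf n), fun h f hf => ?_⟩
  by_cases htop : ∃ n, f n = ⊤
  · obtain ⟨n, hn⟩ := htop
    exact ⟨n, fun m hm => hn ▸ top_le_iff.1 (hn ▸ f.monotone hm)⟩
  · exact h f fun n => (hf n).resolve_left fun hn => htop ⟨n, hn⟩

theorem accOn_colon_iff {R M : Type*} [CommRing R] [AddCommGroup M] [Module R M]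
    {P : Submodule R M → Prop} (hP : ∀ L, P L → ∃ a : R, L = a • (⊤ : Submodule R M)) :
    ACCOn P ↔ ACCOn (fun I : Ideal R => ∃ L : Submodule R M, P L ∧ I = L.colon ⊤) := by
  refine ACCOn.image_iff (fun L L' h => Submodule.colon_mono h le_rfl) fun L L' hL _ hle => ?_
  obtain ⟨a, rfl⟩ := hP L hL
  intro x hx
  obtain ⟨m, -, rfl⟩ := (Submodule.mem_smul_pointwise_iff_exists x a ⊤).1 hx
  refine Submodule.mem_colon.1 (hle (Submodule.mem_colon.2 fun m _ => ?_)) m trivial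
  exact Submodule.smul_mem_pointwise_smul m a ⊤ Submodule.mem_top

theorem comorphic_acc_tfae {R M : Type*} [CommRing R] [AddCommGroup M] [Module R M]
    (hM : Comorphic R M) (hdac : SatisfiesDAC R M) (hI0 : I0 R M ≠ ⊥) :
    List.TFAE
      [ACCOn (fun L : Submodule R M => CompletelyIrreducible L),
       ACCOn (fun I : Ideal R =>
         ∃ L : Submodule R M, CompletelyIrreducible L ∧ I = L.colon ⊤),
       ACCOn (fun N : Submodule R M => FinitelyCogenerated R (M ⧸ N)),
       ACCOn (fun I : Ideal R =>
         ∃ N : Submodule R M, FinitelyCogenerated R (M ⧸ N) ∧ I = N.colon ⊤)] := by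
  have hCI : ∀ L : Submodule R M, CompletelyIrreducible L →
      ∃ a : R, L = a • (⊤ : Submodule R M) := fun L hL => (hM L hL).imp fun _ h => h.1
  have hFC := finitelyCogenerated_quotient_iff fun (L L' : Submodule R M) hL hL' =>
    CompletelyIrreducible.le_total hM hdac hI0 hL hL'
  simp only [hFC]
  tfae_have 1 ↔ 2 := accOn_colon_iff hCI
  tfae_have 3 ↔ 1 := ACCOn.eq_top_or_iff
  tfae_have 3 ↔ 4 := accOn_colon_iff fun L hL =>
    hL.elim (fun h => ⟨1, by rw [h, one_smul]⟩) (hCI L)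
  tfae_finish
end

section
/- Let R be a commutative ring with identity and M a finitely generated R-module such that for every submodule N of M with M/N finitely cogenerated there exists a ∈ R with N = (0 :_M a) = (0 :_M a²). Then M is a comorphic R-module. -/
open Pointwise

theorem finitelyCogenerated_quotient_of_isCoatom {R M : Type*} [CommRing R] [AddCommGroup M]
    [Module R M] {K : Submodule R M} (hK : IsCoatom K) : FinitelyCogenerated R (M ⧸ K) := by
  intro S hS
  have : IsSimpleModule R (M ⧸ K) := isSimpleModule_iff_isCoatom.mpr hK
  by_cases hbot : ⊥ ∈ S
  · exact ⟨{⊥}, by simpa using hbot, by simp⟩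
  · have htop : sInf S = ⊤ := sInf_eq_top.mpr fun N hN ↦
      (eq_bot_or_eq_top N).resolve_left fun h ↦ hbot (h ▸ hN)
    exact absurd (hS.symm.trans htop) bot_ne_top

theorem isSemisimpleModule_of_coatom_eq_torsionBy {R M : Type*} [CommRing R] [AddCommGroup M]
    [Module R M] [Module.Finite R M]
    (h : ∀ K : Submodule R M, IsCoatom K →
      ∃ a : R, K = Submodule.torsionBy R M a ∧ K = Submodule.torsionBy R M (a ^ 2)) :
    IsSemisimpleModule R M := by
  rw [← sSup_simples_eq_top_iff_isSemisimpleModule]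
  by_contra hne
  obtain ⟨K, hK, hle⟩ := (eq_top_or_exists_le_coatom _).resolve_left hne
  obtain ⟨a, ha, ha2⟩ := h K hK
  have : IsSimpleModule R (M ⧸ K) := isSimpleModule_iff_isCoatom.mpr hK
  have hker : K = LinearMap.ker (LinearMap.lsmul R M a) := by
    ext x; simp [ha]
  have hsimple : IsSimpleModule R (LinearMap.range (LinearMap.lsmul R M a)) :=
    IsSimpleModule.congr ((Submodule.quotEquivOfEq _ _ hker).trans
      (LinearMap.quotKerEquivRange _)).symm
  have hrange : LinearMap.range (LinearMap.lsmul R M a) ≤ K :=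
    (le_sSup (a := LinearMap.range (LinearMap.lsmul R M a)) (by exact hsimple)).trans hle
  refine hK.1 (eq_top_iff.mpr fun x _ ↦ ?_)
  have hx : a • x ∈ K := hrange ⟨x, rfl⟩
  rw [ha, Submodule.mem_torsionBy_iff] at hx
  rwa [ha2, Submodule.mem_torsionBy_iff, pow_two, mul_smul]

theorem CompletelyIrreducible.isCoatom {R M : Type*} [CommRing R] [AddCommGroup M] [Module R M]
    [IsSemisimpleModule R M] {L : Submodule R M} (hL : CompletelyIrreducible L) :
    IsCoatom L := by
  refine (hL.2 {K | IsCoatom K ∧ L ≤ K} (le_antisymm (le_sInf fun K hK ↦ hK.2) ?_)).1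
  intro x hx
  have hjac := IsSemisimpleModule.jacobson_eq_bot R (M ⧸ L)
  rw [← Submodule.Quotient.mk_eq_zero L, ← Submodule.mem_bot R, ← hjac, Module.jacobson,
    Submodule.mem_sInf]
  intro N hN
  refine (Submodule.mem_sInf.mp hx) (N.comap L.mkQ) ⟨?_, L.le_comap_mkQ N⟩
  exact (Submodule.isCoatom_comap_iff L.mkQ_surjective).mpr hN

theorem comorphic_of_torsion_condition {R M : Type*} [CommRing R] [AddCommGroup M] [Module R M]
    [Module.Finite R M]
    (h : ∀ N : Submodule R M, FinitelyCogenerated R (M ⧸ N) →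
      ∃ a : R, N = Submodule.torsionBy R M a ∧ N = Submodule.torsionBy R M (a ^ 2)) :
    Comorphic R M := by
  intro L hL
  have hss : IsSemisimpleModule R M := isSemisimpleModule_of_coatom_eq_torsionBy fun K hK ↦
    h K (finitelyCogenerated_quotient_of_isCoatom hK)
  have hco := hL.isCoatom
  obtain ⟨a, ha, ha2⟩ := h L (finitelyCogenerated_quotient_of_isCoatom hco)
  have memL (x : M) : x ∈ L ↔ a • x = 0 := by rw [ha, Submodule.mem_torsionBy_iff]
  obtain ⟨x, hx⟩ : ∃ x, x ∉ L := by
    by_contra! hall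
    exact hco.1 (eq_top_iff.mpr fun x _ ↦ hall x)
  have hax : a • x ∉ L := fun hax ↦ hx <| by
    rwa [ha2, Submodule.mem_torsionBy_iff, pow_two, mul_smul, ← memL]
  have : IsSimpleModule R (M ⧸ L) := isSimpleModule_iff_isCoatom.mpr hco
  have hspan (y : M) (hy : y ∉ L) (z : M) : ∃ r : R, z - r • y ∈ L := by
    have hy' : L.mkQ y ≠ 0 := by simpa using hy
    obtain ⟨r, hr⟩ := IsSimpleModule.toSpanSingleton_surjective R hy' (L.mkQ z)
    refine ⟨r, ?_⟩
    rw [← Submodule.Quotient.mk_eq_zero]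
    simpa [sub_eq_zero] using hr.symm
  obtain ⟨r, hr⟩ := hspan _ hax x
  have hb (z : M) : (1 - r * a) • z ∈ L := by
    obtain ⟨s, hs⟩ := hspan x hx z
    have key : (1 - r * a) • z = (1 - r * a) • (z - s • x) + s • (x - r • a • x) := by
      module
    rw [key]
    exact L.add_mem (L.smul_mem _ hs) (L.smul_mem _ hr)
  refine ⟨1 - r * a, le_antisymm (fun z hz ↦ ?_) ?_, le_antisymm (fun c hc ↦ ?_) ?_⟩
  · refine Submodule.mem_smul_pointwise_iff_exists _ _ _ |>.mpr ⟨z, trivial, ?_⟩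
    rw [sub_smul, mul_smul, (memL z).mp hz, smul_zero, sub_zero, one_smul]
  · intro z hz
    obtain ⟨y, -, rfl⟩ := (Submodule.mem_smul_pointwise_iff_exists _ _ _).mp hz
    exact hb y
  · rw [Submodule.mem_colon] at hc
    refine Submodule.mem_sup.mpr ⟨c * (1 - r * a),
      Ideal.mul_mem_left _ _ (Ideal.mem_span_singleton_self _), c * (r * a), ?_, by ring⟩
    refine Submodule.mem_annihilator.mpr fun y hy ↦ ?_
    have := (memL _).mp (hc y hy)
    rw [show (c * (r * a)) • y = r • a • c • y by module, this, smul_zero]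
  · refine sup_le ((Ideal.span_singleton_le_iff_mem _).mpr ?_) fun c hc ↦ ?_
    · exact Submodule.mem_colon.mpr fun y _ ↦ hb y
    · refine Submodule.mem_colon.mpr fun y _ ↦ ?_
      rw [Submodule.mem_annihilator.mp hc y trivial]
      exact L.zero_mem
end

section
/- Let R₁ and R₂ be commutative rings with identity, M₁ an R₁-module and M₂ an R₂-module, and consider M = M₁ × M₂ as a module over R = R₁ × R₂ with componentwise operations. Then M is a comorphic R-module if and only if M₁ is a comorphic R₁-module and M₂ is a comorphic R₂-module. -/
open Pointwise

section Prod

variable {R₁ R₂ M₁ M₂ : Type*} [CommRing R₁] [CommRing R₂]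
  [AddCommGroup M₁] [Module R₁ M₁] [AddCommGroup M₂] [Module R₂ M₂]

/-- The componentwise scalar action of `R₁ × R₂` on `M₁ × M₂`. -/
instance Prod.pairSMul : SMul (R₁ × R₂) (M₁ × M₂) :=
  ⟨fun r m => (r.1 • m.1, r.2 • m.2)⟩

/-- `M₁ × M₂` is a module over `R₁ × R₂` with componentwise operations. -/
instance Prod.pairModule : Module (R₁ × R₂) (M₁ × M₂) where
  one_smul _ := Prod.ext (one_smul _ _) (one_smul _ _)
  mul_smul _ _ _ := Prod.ext (mul_smul _ _ _) (mul_smul _ _ _)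
  smul_zero _ := Prod.ext (smul_zero _) (smul_zero _)
  smul_add _ _ _ := Prod.ext (smul_add _ _ _) (smul_add _ _ _)
  add_smul _ _ _ := Prod.ext (add_smul _ _ _) (add_smul _ _ _)
  zero_smul _ := Prod.ext (zero_smul _ _) (zero_smul _ _)

end Prod

/-- An element of a complete lattice is completely meet-irreducible if it is not `⊤` and belongs
to every set of which it is the infimum. -/
def CompletelyInfIrred {α : Type*} [CompleteLattice α] (x : α) : Prop :=
  x ≠ ⊤ ∧ ∀ S : Set α, x = sInf S → x ∈ S

namespace CompletelyInfIrred

variable {α β : Type*} [CompleteLattice α] [CompleteLattice β]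

theorem map_orderIso (e : α ≃o β) {x : α} (h : CompletelyInfIrred x) :
    CompletelyInfIrred (e x) := by
  refine ⟨fun hx => h.1 (e.injective (hx.trans e.map_top.symm)), fun S hS => ?_⟩
  have key : x = sInf (e.symm '' S) := by
    rw [sInf_image, ← OrderIso.map_sInf, ← hS, e.symm_apply_apply]
  obtain ⟨y, hy, hyx⟩ := h.2 _ key
  rw [← hyx, e.apply_symm_apply]
  exact hy

theorem orderIso_iff (e : α ≃o β) {x : α} :
    CompletelyInfIrred (e x) ↔ CompletelyInfIrred x :=
  ⟨fun h => by simpa using h.map_orderIso e.symm, map_orderIso e⟩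

theorem prod_top_iff {a : α} :
    CompletelyInfIrred (a, (⊤ : β)) ↔ CompletelyInfIrred a := by
  constructor
  · refine fun h => ⟨fun ha => h.1 (Prod.ext ha rfl), fun S hS => ?_⟩
    have key : (a, (⊤ : β)) = sInf ((fun x => (x, (⊤ : β))) '' S) := by
      refine Prod.ext ?_ ?_
      · simpa [Prod.fst_sInf, Set.image_image] using hS
      · rw [Prod.snd_sInf, Set.image_image]
        refine (sInf_eq_top.2 ?_).symm
        rintro _ ⟨_, _, rfl⟩
        rfl
    obtain ⟨y, hy, hya⟩ := h.2 _ key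
    have hy_eq : y = a := congrArg Prod.fst hya
    rwa [← hy_eq]
  · refine fun h => ⟨fun ha => h.1 (congrArg Prod.fst ha), fun T hT => ?_⟩
    obtain ⟨t, ht, hta⟩ := h.2 (Prod.fst '' T) ((congrArg Prod.fst hT).trans (Prod.fst_sInf T))
    have ht2 : t.2 = ⊤ := top_le_iff.1 (hT.le.trans (sInf_le ht)).2
    rwa [show (a, (⊤ : β)) = t from Prod.ext hta.symm ht2.symm]

theorem top_prod_iff {b : β} :
    CompletelyInfIrred ((⊤ : α), b) ↔ CompletelyInfIrred b :=
  (orderIso_iff OrderIso.prodComm).symm.trans prod_top_iff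

theorem eq_top_or_eq_top {p : α × β} (h : CompletelyInfIrred p) : p.1 = ⊤ ∨ p.2 = ⊤ := by
  have key : p = sInf {(p.1, ⊤), (⊤, p.2)} := by
    rw [sInf_pair]
    exact Prod.ext (by simp) (by simp)
  rcases h.2 _ key with hp | hp
  · exact Or.inr (congrArg Prod.snd hp)
  · exact Or.inl (congrArg Prod.fst hp)

end CompletelyInfIrred

/-- The scalar `a` witnesses the comorphic condition for the submodule `L`. -/
def IsComorphicWitness {R M : Type*} [CommRing R] [AddCommGroup M] [Module R M]
    (a : R) (L : Submodule R M) : Prop :=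
  L = a • (⊤ : Submodule R M) ∧
    L.colon ⊤ = Ideal.span {a} + (⊤ : Submodule R M).annihilator

theorem isComorphicWitness_iff {R M : Type*} [CommRing R] [AddCommGroup M] [Module R M]
    {a : R} {L : Submodule R M} :
    IsComorphicWitness a L ↔ (∀ x, x ∈ L ↔ ∃ m : M, a • m = x) ∧
      ∀ r : R, (∀ m : M, r • m ∈ L) ↔ ∃ s : R, ∀ m : M, r • m = (s * a) • m := by
  refine and_congr ?_ ?_
  · simp [SetLike.ext_iff, Submodule.mem_smul_pointwise_iff_exists]
  · rw [SetLike.ext_iff]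
    refine forall_congr' fun r => iff_congr ?_ ?_
    · simp [Submodule.mem_colon]
    · rw [Submodule.add_eq_sup, Submodule.mem_sup]
      constructor
      · rintro ⟨y, hy, z, hz, rfl⟩
        obtain ⟨s, rfl⟩ := Ideal.mem_span_singleton'.1 hy
        refine ⟨s, fun m => ?_⟩
        rw [add_smul, Submodule.mem_annihilator.1 hz m trivial, add_zero]
      · rintro ⟨s, hs⟩
        refine ⟨s * a, Ideal.mem_span_singleton'.2 ⟨s, rfl⟩, r - s * a, ?_, by ring⟩
        refine Submodule.mem_annihilator.2 fun m _ => ?_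
        rw [sub_smul, hs, sub_self]

theorem isComorphicWitness_one_top {R M : Type*} [CommRing R] [AddCommGroup M] [Module R M] :
    IsComorphicWitness (1 : R) (⊤ : Submodule R M) := by
  simp only [isComorphicWitness_iff]
  exact ⟨fun x => ⟨fun _ => ⟨x, one_smul _ _⟩, fun _ => trivial⟩,
    fun r => ⟨fun _ => ⟨r, fun m => by rw [mul_one]⟩, fun _ _ => trivial⟩⟩

section PairModule

variable {R₁ R₂ M₁ M₂ : Type*} [CommRing R₁] [CommRing R₂]
  [AddCommGroup M₁] [Module R₁ M₁] [AddCommGroup M₂] [Module R₂ M₂]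

/-- Submodules of `M₁ × M₂` over `R₁ × R₂` are the products of a submodule of `M₁` over `R₁`
and a submodule of `M₂` over `R₂`. -/
def Submodule.pairProd :
    Submodule R₁ M₁ × Submodule R₂ M₂ ≃o Submodule (R₁ × R₂) (M₁ × M₂) where
  toFun L :=
    { carrier := {x | x.1 ∈ L.1 ∧ x.2 ∈ L.2}
      add_mem' := fun hx hy => ⟨L.1.add_mem hx.1 hy.1, L.2.add_mem hx.2 hy.2⟩
      zero_mem' := ⟨L.1.zero_mem, L.2.zero_mem⟩
      smul_mem' := fun r _ hx => ⟨L.1.smul_mem r.1 hx.1, L.2.smul_mem r.2 hx.2⟩ }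
  invFun N :=
    ({ carrier := {x | (x, 0) ∈ N}
       add_mem' := fun hx hy => by simpa using N.add_mem hx hy
       zero_mem' := N.zero_mem
       smul_mem' := fun r x hx => by
        have h : ((r • x, (0 : R₂) • (0 : M₂)) : M₁ × M₂) ∈ N := N.smul_mem (r, 0) hx
        simpa using h },
     { carrier := {x | (0, x) ∈ N}
       add_mem' := fun hx hy => by simpa using N.add_mem hx hy
       zero_mem' := N.zero_mem
       smul_mem' := fun r x hx => by
        have h : (((0 : R₁) • (0 : M₁), r • x) : M₁ × M₂) ∈ N := N.smul_mem (0, r) hx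
        simpa using h })
  left_inv L := Prod.ext
    (Submodule.ext fun x => ⟨fun h => h.1, fun h => ⟨h, L.2.zero_mem⟩⟩)
    (Submodule.ext fun x => ⟨fun h => h.2, fun h => ⟨L.1.zero_mem, h⟩⟩)
  right_inv N := by
    refine Submodule.ext fun x => ⟨fun h => ?_, fun h => ⟨?_, ?_⟩⟩
    · simpa using N.add_mem h.1 h.2
    · have hx : (((1 : R₁) • x.1, (0 : R₂) • x.2) : M₁ × M₂) ∈ N := N.smul_mem (1, 0) h
      simpa using hx
    · have hx : (((0 : R₁) • x.1, (1 : R₂) • x.2) : M₁ × M₂) ∈ N := N.smul_mem (0, 1) h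
      simpa using hx
  map_rel_iff' {L L'} :=
    ⟨fun h => ⟨fun _ hx => (@h (_, 0) ⟨hx, L.2.zero_mem⟩).1,
      fun _ hx => (@h (0, _) ⟨L.1.zero_mem, hx⟩).2⟩,
      fun h _ hx => ⟨h.1 hx.1, h.2 hx.2⟩⟩

theorem Submodule.mem_pairProd {L : Submodule R₁ M₁ × Submodule R₂ M₂} {x : M₁ × M₂} :
    x ∈ Submodule.pairProd L ↔ x.1 ∈ L.1 ∧ x.2 ∈ L.2 :=
  Iff.rfl

theorem isComorphicWitness_pairProd_iff {a : R₁ × R₂}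
    {L : Submodule R₁ M₁ × Submodule R₂ M₂} :
    IsComorphicWitness a (Submodule.pairProd L) ↔
      IsComorphicWitness a.1 L.1 ∧ IsComorphicWitness a.2 L.2 := by
  have smul_def (r : R₁ × R₂) (m : M₁ × M₂) : r • m = (r.1 • m.1, r.2 • m.2) := rfl
  simp only [isComorphicWitness_iff, Submodule.mem_pairProd, smul_def, Prod.forall, Prod.exists,
    Prod.mk.injEq, Prod.fst_mul, Prod.snd_mul]
  constructor
  · rintro ⟨h, h'⟩
    refine ⟨⟨fun x => ?_, fun r => ?_⟩, ⟨fun x => ?_, fun r => ?_⟩⟩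
    · have := h x 0
      exact ⟨fun hx => let ⟨m, _, hm, _⟩ := this.1 ⟨hx, zero_mem _⟩; ⟨m, hm⟩,
        fun ⟨m, hm⟩ => (this.2 ⟨m, 0, hm, smul_zero _⟩).1⟩
    · have := h' r 0
      refine ⟨fun hr => ?_, fun ⟨s, hs⟩ m => ?_⟩
      · obtain ⟨s, _, hs⟩ := this.1 fun m n => ⟨hr m, by simp⟩
        exact ⟨s, fun m => (hs m 0).1⟩
      · exact (this.2 ⟨s, 0, fun m n => ⟨hs m, by simp⟩⟩ m 0).1
    · have := h 0 x
      exact ⟨fun hx => let ⟨_, m, _, hm⟩ := this.1 ⟨zero_mem _, hx⟩; ⟨m, hm⟩,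
        fun ⟨m, hm⟩ => (this.2 ⟨0, m, smul_zero _, hm⟩).2⟩
    · have := h' 0 r
      refine ⟨fun hr => ?_, fun ⟨s, hs⟩ m => ?_⟩
      · obtain ⟨_, s, hs⟩ := this.1 fun m n => ⟨by simp, hr n⟩
        exact ⟨s, fun m => (hs 0 m).2⟩
      · exact (this.2 ⟨0, s, fun m n => ⟨by simp, hs n⟩⟩ 0 m).2
  · rintro ⟨⟨h₁, h₁'⟩, ⟨h₂, h₂'⟩⟩
    refine ⟨fun x y => ?_, fun r t => ⟨fun h => ?_, fun ⟨s, u, h⟩ m n => ?_⟩⟩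
    · rw [h₁, h₂]
      exact ⟨fun ⟨⟨m, hm⟩, ⟨n, hn⟩⟩ => ⟨m, n, hm, hn⟩,
        fun ⟨m, n, hm, hn⟩ => ⟨⟨m, hm⟩, ⟨n, hn⟩⟩⟩
    · obtain ⟨s, hs⟩ := (h₁' r).1 fun m => (h m 0).1
      obtain ⟨u, hu⟩ := (h₂' t).1 fun n => (h 0 n).2
      exact ⟨s, u, fun m n => ⟨hs m, hu n⟩⟩
    · exact ⟨(h₁' r).2 ⟨s, fun m => (h m 0).1⟩ m, (h₂' t).2 ⟨u, fun n => (h 0 n).2⟩ n⟩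

end PairModule

theorem comorphic_prod_iff
    {R₁ R₂ M₁ M₂ : Type*} [CommRing R₁] [CommRing R₂]
    [AddCommGroup M₁] [Module R₁ M₁] [AddCommGroup M₂] [Module R₂ M₂] :
    Comorphic (R₁ × R₂) (M₁ × M₂) ↔ Comorphic R₁ M₁ ∧ Comorphic R₂ M₂ := by
  constructor
  · refine fun h => ⟨fun L hL => ?_, fun L hL => ?_⟩
    · obtain ⟨a, ha⟩ := h (Submodule.pairProd (L, ⊤))
        ((CompletelyInfIrred.orderIso_iff _).2 (CompletelyInfIrred.prod_top_iff.2 hL))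
      exact ⟨a.1, (isComorphicWitness_pairProd_iff.1 ha).1⟩
    · obtain ⟨a, ha⟩ := h (Submodule.pairProd (⊤, L))
        ((CompletelyInfIrred.orderIso_iff _).2 (CompletelyInfIrred.top_prod_iff.2 hL))
      exact ⟨a.2, (isComorphicWitness_pairProd_iff.1 ha).2⟩
  · rintro ⟨h₁, h₂⟩ N hN
    obtain ⟨⟨L₁, L₂⟩, rfl⟩ := Submodule.pairProd.surjective N
    have hL := (CompletelyInfIrred.orderIso_iff _).1 hN
    rcases hL.eq_top_or_eq_top with rfl | rfl
    · obtain ⟨a, ha⟩ := h₂ L₂ (CompletelyInfIrred.top_prod_iff.1 hL)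
      exact ⟨(1, a), isComorphicWitness_pairProd_iff.2 ⟨isComorphicWitness_one_top, ha⟩⟩
    · obtain ⟨a, ha⟩ := h₁ L₁ (CompletelyInfIrred.prod_top_iff.1 hL)
      exact ⟨(a, 1), isComorphicWitness_pairProd_iff.2 ⟨ha, isComorphicWitness_one_top⟩⟩
end

section
/- Let R be a commutative ring with identity. Every morphic R-module M is co-Hopfian, i.e., every injective R-endomorphism of M is an isomorphism. -/
open Pointwise

/-- `M` is a morphic `R`-module if for each `m ∈ M` there is `a ∈ R` with
`Rm = (0 :_M a)` and `Ann_R(Rm) = Ra + Ann_R(M)`. -/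
def Morphic (R M : Type*) [CommRing R] [AddCommGroup M] [Module R M] : Prop :=
  ∀ m : M, ∃ a : R, Submodule.span R {m} = Submodule.torsionBy R M a ∧
    (Submodule.span R {m}).annihilator = Ideal.span {a} + (⊤ : Submodule R M).annihilator

theorem morphic_coHopfian {R M : Type*} [CommRing R] [AddCommGroup M] [Module R M]
    (hM : Morphic R M) :
    ∀ f : M →ₗ[R] M, Function.Injective f → Function.Bijective f := by
  intro f hf
  refine ⟨hf, fun m => ?_⟩
  obtain ⟨a, ha, -⟩ := hM (f m)
  have hfm : a • f m = 0 := by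
    rw [← Submodule.mem_torsionBy_iff, ← ha]
    exact Submodule.mem_span_singleton_self _
  have hm : a • m = 0 := hf (by rw [map_smul, hfm, map_zero])
  rw [← Submodule.mem_torsionBy_iff, ← ha, Submodule.mem_span_singleton] at hm
  obtain ⟨r, hr⟩ := hm
  exact ⟨r • m, by rw [map_smul, hr]⟩
end

section
/- Let R be a commutative ring with identity and M a cyclic R-module. If M is a morphic R-module in the sense of Nicholson and Sánchez Campos (i.e., for every R-endomorphism f of M, M/f(M) ≅ ker f as R-modules), then M is a quasi morphic R-module, i.e., for each a ∈ R, the submodule (0 :_M a) is a cyclic submodule of M and Ann_R((0 :_M a)) = Ra + Ann_R(M). -/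
open Pointwise

theorem quasiMorphic_of_cyclic_NS_morphic {R M : Type*} [CommRing R] [AddCommGroup M] [Module R M]
    (hcyc : (⊤ : Submodule R M).IsPrincipal)
    (hmor : ∀ f : M →ₗ[R] M,
      Nonempty ((M ⧸ LinearMap.range f) ≃ₗ[R] LinearMap.ker f)) :
    ∀ a : R, (Submodule.torsionBy R M a).IsPrincipal ∧
      (Submodule.torsionBy R M a).annihilator =
        Ideal.span {a} + (⊤ : Submodule R M).annihilator := by
  intro a
  obtain ⟨m, hm⟩ := hcyc
  have gen (x : M) : ∃ r : R, r • m = x :=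
    Submodule.mem_span_singleton.1 (hm ▸ Submodule.mem_top)
  obtain ⟨e⟩ := hmor (LinearMap.lsmul R M a)
  have mem_ker (x : M) : x ∈ LinearMap.ker (LinearMap.lsmul R M a) ↔
      x ∈ Submodule.torsionBy R M a := by
    simp
  set g := e (Submodule.Quotient.mk m) with hg
  have torsionBy_eq : Submodule.torsionBy R M a = Submodule.span R {(g : M)} := by
    ext x
    rw [Submodule.mem_span_singleton]
    constructor
    · intro hx
      obtain ⟨y, hy⟩ := e.surjective ⟨x, (mem_ker x).2 hx⟩
      obtain ⟨z, rfl⟩ := Submodule.Quotient.mk_surjective _ y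
      obtain ⟨r, rfl⟩ := gen z
      refine ⟨r, ?_⟩
      rw [Submodule.Quotient.mk_smul, map_smul] at hy
      exact congrArg Subtype.val hy
    · rintro ⟨r, rfl⟩
      exact Submodule.smul_mem _ r ((mem_ker _).1 g.2)
  refine ⟨⟨_, torsionBy_eq⟩, ?_⟩
  ext r
  have smul_gen_eq_zero : r • (g : M) = 0 ↔ ∃ s : R, a • s • m = r • m := by
    rw [← Submodule.coe_smul, Submodule.coe_eq_zero, hg, ← map_smul,
      LinearEquiv.map_eq_zero_iff, ← Submodule.Quotient.mk_smul, Submodule.Quotient.mk_eq_zero,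
      LinearMap.mem_range]
    constructor
    · rintro ⟨y, hy⟩
      obtain ⟨s, rfl⟩ := gen y
      exact ⟨s, hy⟩
    · rintro ⟨s, hs⟩
      exact ⟨s • m, hs⟩
  rw [torsionBy_eq, hm, Submodule.mem_annihilator_span_singleton, smul_gen_eq_zero,
    Submodule.add_eq_sup, Ideal.mem_span_singleton_sup]
  constructor
  · rintro ⟨s, hs⟩
    refine ⟨s, r - s * a, ?_, by ring⟩
    rw [Submodule.mem_annihilator_span_singleton, sub_smul, ← hs, mul_comm, mul_smul, sub_self]
  · rintro ⟨s, b, hb, rfl⟩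
    rw [Submodule.mem_annihilator_span_singleton] at hb
    exact ⟨s, by rw [add_smul, hb, add_zero, mul_comm, mul_smul]⟩
end
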